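/- arXiv:2312.07710 — 2 statements merged into one kernel-verified Lean document; each statement's English description precedes it below -/
import Mathlib

section
/- Suppose k = 2 (so n ≥ 5 and gcd(n, 6) = 1). Then Δ_{n,2} = Σ_{r=1}^{(n−1)/2} w_r T_r in ⋀² M, where w_r = 1 if r ≡ 0 (mod 3), w_r = −1 if r ≡ n (mod 3), and w_r = 0 otherwise. -/
open scoped Classical

noncomputable section

namespace Stmt

open ExteriorAlgebra

/-- `T n e r = Σ_{i=0}^{n-1} e_i ∧ e_{i+r}` in the exterior algebra of `M`. -/
def T (n : ℕ) {M : Type*} [AddCommGroup M] [Module ℤ M] (e : ZMod n → M)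
    (r : ZMod n) : ExteriorAlgebra ℤ M :=
  ∑ i ∈ Finset.range n, ι ℤ (e i) * ι ℤ (e ((i : ZMod n) + r))

/-- The coefficient `c_{I,J} = a⁺_{I,J} − a⁻_{I,J}`. -/
def cIJ (n k c : ℕ) (I J : ℕ) : ℤ :=
  (if ∃ j ∈ Finset.Icc 1 (c - 1),
      ((J : ZMod n) - (I : ZMod n)) = (j : ZMod n) * ((k : ZMod n) + 1) then 1 else 0)
  - (if ∃ j ∈ Finset.Icc 1 (c - 1),
      ((J : ZMod n) - (I : ZMod n)) = (j : ZMod n) * ((k : ZMod n) + 1) - 1 then 1 else 0)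

/-- The classifying element `Δ_{n,k} = Σ_{1 ≤ I < J ≤ n−1} c_{I,J} · e_I ∧ e_J`. -/
def Δ (n k c : ℕ) {M : Type*} [AddCommGroup M] [Module ℤ M] (e : ZMod n → M) :
    ExteriorAlgebra ℤ M :=
  ∑ I ∈ Finset.Icc 1 (n - 1), ∑ J ∈ Finset.Ioc I (n - 1),
    cIJ n k c I J • (ι ℤ (e (I : ZMod n)) * ι ℤ (e (J : ZMod n)))

/-- The weight. -/
def wt (n r : ℕ) : ℤ := if r % 3 = 0 then (1 : ℤ) else if r % 3 = n % 3 then -1 else 0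

lemma exists_iff (n c x : ℕ) (hn0 : n % 3 ≠ 0) (hx1 : 1 ≤ x) (hx2 : x ≤ n - 1)
    (hc : c * 3 = n + 1 ∨ c * 3 = 2 * n + 1) :
    (∃ j ∈ Finset.Icc 1 (c - 1), (x : ZMod n) = (j : ZMod n) * 3) ↔
      (x % 3 = 0 ∨ (n % 3 = 1 ∧ x % 3 = 2)) := by
  constructor
  · rintro ⟨j, hj, h⟩
    rw [Finset.mem_Icc] at hj
    have h2 : ((x : ℕ) : ZMod n) = ((j * 3 : ℕ) : ZMod n) := by
      rw [h]; push_cast; rfl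
    rw [ZMod.natCast_eq_natCast_iff'] at h2
    rw [Nat.mod_eq_of_lt (by omega : x < n)] at h2
    have h3 : j * 3 = x ∨ j * 3 = x + n := by
      by_cases h4 : j * 3 < n
      · left; rw [Nat.mod_eq_of_lt h4] at h2; exact h2.symm
      · right
        rw [Nat.mod_eq_sub_mod (by omega), Nat.mod_eq_of_lt (by omega)] at h2
        omega
    omega
  · intro h
    by_cases h0 : x % 3 = 0
    · refine ⟨x / 3, by rw [Finset.mem_Icc]; omega, ?_⟩
      have : x = x / 3 * 3 := by omega
      exact_mod_cast congrArg (Nat.cast : ℕ → ZMod n) this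
    · refine ⟨(x + n) / 3, by rw [Finset.mem_Icc]; omega, ?_⟩
      have : x + n = (x + n) / 3 * 3 := by omega
      have h5 := congrArg (Nat.cast : ℕ → ZMod n) this
      rw [Nat.cast_add, ZMod.natCast_self, add_zero] at h5
      exact_mod_cast h5

lemma cIJ_eq (n c I J : ℕ) (hn0 : n % 3 ≠ 0) (hI : 1 ≤ I) (hIJ : I < J) (hJ : J ≤ n - 1)
    (hc : c * 3 = n + 1 ∨ c * 3 = 2 * n + 1) : cIJ n 2 c I J = wt n (J - I) := by
  have e1 : ((J : ZMod n) - (I : ZMod n)) = ((J - I : ℕ) : ZMod n) := by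
    rw [Nat.cast_sub hIJ.le]
  have e2 : (((2 : ℕ) : ZMod n) + 1) = 3 := by norm_num
  have A := exists_iff n c (J - I) hn0 (by omega) (by omega) hc
  have B := exists_iff n c (J - I + 1) hn0 (by omega) (by omega) hc
  unfold cIJ wt
  simp only [e1, e2, eq_sub_iff_add_eq]
  rw [Nat.cast_add, Nat.cast_one] at B
  rw [if_congr A rfl rfl, if_congr B rfl rfl]
  split_ifs <;> omega

section
variable {A : Type*} [AddCommGroup A]

/-- Diagonal sums. -/
def S (n : ℕ) (g : ℕ → ℕ → A) (d : ℕ) : A := ∑ i ∈ Finset.range (n - d), g i (i + d)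

lemma tri_sum (n : ℕ) (g : ℕ → ℕ → A) (h0 : ∀ j, g 0 j = 0) (w : ℕ → ℤ) :
    ∑ I ∈ Finset.Icc 1 (n - 1), ∑ J ∈ Finset.Ioc I (n - 1), w (J - I) • g I J
      = ∑ d ∈ Finset.Icc 1 (n - 1), w d • S n g d := by
  have h1 : ∀ d ∈ Finset.Icc 1 (n - 1),
      w d • S n g d = ∑ i ∈ Finset.Icc 1 (n - 1 - d), w d • g i (i + d) := by
    intro d hd
    rw [Finset.mem_Icc] at hd
    rw [← Finset.smul_sum]
    congr 1
    unfold S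
    symm
    apply Finset.sum_subset
    · intro i hi
      rw [Finset.mem_Icc] at hi
      rw [Finset.mem_range]; omega
    · intro i hi hi2
      rw [Finset.mem_Icc] at hi2
      rw [Finset.mem_range] at hi
      have : i = 0 := by omega
      rw [this, h0]
  rw [Finset.sum_congr rfl h1, Finset.sum_sigma', Finset.sum_sigma']
  refine Finset.sum_bij' (fun p _ => ⟨p.2 - p.1, p.1⟩) (fun p _ => ⟨p.2, p.2 + p.1⟩) ?_ ?_ ?_ ?_ ?_
  · rintro ⟨I, J⟩ h
    simp only [Finset.mem_sigma, Finset.mem_Icc, Finset.mem_Ioc] at h ⊢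
    omega
  · rintro ⟨I, J⟩ h
    simp only [Finset.mem_sigma, Finset.mem_Icc, Finset.mem_Ioc] at h ⊢
    omega
  · rintro ⟨I, J⟩ h
    simp only [Finset.mem_sigma, Finset.mem_Icc, Finset.mem_Ioc] at h
    have : I + (J - I) = J := by omega
    simp [this]
  · rintro ⟨I, J⟩ h
    simp
  · rintro ⟨I, J⟩ h
    simp only [Finset.mem_sigma, Finset.mem_Icc, Finset.mem_Ioc] at h
    have : I + (J - I) = J := by omega
    simp [this]

lemma fold_sum (m : ℕ) (F : ℕ → A) :
    ∑ d ∈ Finset.Icc 1 (2 * m), F d = ∑ r ∈ Finset.Icc 1 m, (F r + F (2 * m + 1 - r)) := by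
  rw [Finset.sum_add_distrib]
  have h : ∑ r ∈ Finset.Icc 1 m, F (2 * m + 1 - r) = ∑ d ∈ Finset.Icc (m + 1) (2 * m), F d := by
    refine Finset.sum_bij' (fun r _ => 2 * m + 1 - r) (fun r _ => 2 * m + 1 - r) ?_ ?_ ?_ ?_ ?_
    · intro a ha; rw [Finset.mem_Icc] at *; omega
    · intro a ha; rw [Finset.mem_Icc] at *; omega
    · intro a ha; rw [Finset.mem_Icc] at *; omega
    · intro a ha; rw [Finset.mem_Icc] at *; omega
    · intro a ha; rfl
  rw [h, ← Finset.sum_union]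
  · congr 1
    ext a; simp only [Finset.mem_union, Finset.mem_Icc]; omega
  · rw [Finset.disjoint_left]
    intro a ha hb; rw [Finset.mem_Icc] at *; omega

end

lemma T_eq (n r : ℕ) (hr : r ≤ n) {M : Type*} [AddCommGroup M] [Module ℤ M] (e : ZMod n → M) :
    T n e (r : ZMod n) = S n (fun i j => ι ℤ (e (i : ZMod n)) * ι ℤ (e (j : ZMod n))) r
      - S n (fun i j => ι ℤ (e (i : ZMod n)) * ι ℤ (e (j : ZMod n))) (n - r) := by
  unfold T S
  have h : n = (n - r) + r := by omega
  have h' : n - (n - r) = r := by omega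
  rw [h']
  conv_lhs => rw [show Finset.range n = Finset.range ((n - r) + r) from congrArg _ h]
  rw [Finset.sum_range_add, sub_eq_add_neg, ← Finset.sum_neg_distrib]
  congr 1
  · apply Finset.sum_congr rfl
    intro i _
    simp only [Nat.cast_add]
  · apply Finset.sum_congr rfl
    intro i _
    have e1 : (((n - r + i : ℕ) : ZMod n) + (r : ZMod n)) = (i : ZMod n) := by
      rw [← Nat.cast_add, show n - r + i + r = n + i by omega, Nat.cast_add, ZMod.natCast_self,
        zero_add]
    rw [e1, add_comm (n - r) i, eq_neg_iff_add_eq_zero]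
    exact ι_add_mul_swap _ _

theorem stmt10 (n k c : ℕ) (hn : Odd n) (hn3 : 3 ≤ n)
    (hk1 : 1 ≤ k) (hk2 : k ≤ n - 2) (hgcd : Nat.gcd n (k * (k + 1)) = 1)
    (hc1 : 1 ≤ c) (hc2 : c ≤ n - 1) (hc : (c * (k + 1)) % n = 1)
    (M : Type*) [AddCommGroup M] [Module ℤ M]
    (e : ZMod n → M) (he0 : e 0 = 0)
    (heInd : LinearIndependent ℤ (fun i : {x : ZMod n // x ≠ 0} => e i.val))
    (hk : k = 2) :
    Δ n k c e = ∑ r ∈ Finset.Icc 1 ((n - 1) / 2), (if r % 3 = 0 then (1 : ℤ) else if r % 3 = n % 3 then -1 else 0) • T n e (r : ZMod n) := by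
  subst hk
  have hn0 : n % 3 ≠ 0 := by
    intro h
    have h3 : 3 ∣ Nat.gcd n (2 * (2 + 1)) := Nat.dvd_gcd (Nat.dvd_of_mod_eq_zero h) (by norm_num)
    rw [hgcd] at h3
    omega
  have hc' : c * 3 = n + 1 ∨ c * 3 = 2 * n + 1 := by
    have h1 := Nat.div_add_mod (c * (2 + 1)) n
    rw [hc] at h1
    generalize c * (2 + 1) / n = t at h1
    have ht : t < 3 := by
      by_contra hcon
      have : n * 3 ≤ n * t := Nat.mul_le_mul_left _ (by omega)
      omega
    interval_cases t <;> omega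
  obtain ⟨m, hndef⟩ := hn
  have hL : Δ n 2 c e = ∑ I ∈ Finset.Icc 1 (n - 1), ∑ J ∈ Finset.Ioc I (n - 1),
      wt n (J - I) • (ι ℤ (e (I : ZMod n)) * ι ℤ (e (J : ZMod n))) := by
    unfold Δ
    refine Finset.sum_congr rfl fun I hI => Finset.sum_congr rfl fun J hJ => ?_
    rw [Finset.mem_Icc] at hI
    rw [Finset.mem_Ioc] at hJ
    rw [cIJ_eq n c I J hn0 hI.1 hJ.1 hJ.2 hc']
  rw [hL, tri_sum n (fun i j => ι ℤ (e (i : ZMod n)) * ι ℤ (e (j : ZMod n)))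
    (by intro j; simp [he0]) (wt n)]
  rw [show n - 1 = 2 * m by omega, fold_sum, show 2 * m / 2 = m by omega]
  refine Finset.sum_congr rfl fun r hr => ?_
  rw [Finset.mem_Icc] at hr
  rw [T_eq n r (by omega)]
  have hw : wt n (2 * m + 1 - r) = - wt n r := by
    unfold wt
    split_ifs <;> omega
  rw [hw, ← hndef, neg_smul, smul_sub, ← sub_eq_add_neg]
  rfl

end Stmt
end
end

section
/- Suppose n ≡ 2 (mod 3) and k = (n−2)/3. Then Δ_{n,k} = T_{k+1} − T_k in ⋀² M. -/
open scoped Classical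

noncomputable section

namespace Stmt

open ExteriorAlgebra

lemma zmod_diff (n I J d : ℕ) (hIJ : I < J) (hJ : J < n) (hd : d < n) :
    ((J : ZMod n) - (I : ZMod n) = (d : ZMod n)) ↔ J = I + d := by
  rw [← Nat.cast_sub hIJ.le, ZMod.natCast_eq_natCast_iff]
  constructor
  · intro h
    have := Nat.ModEq.eq_of_lt_of_lt h (by omega) hd
    omega
  · intro h
    have : J - I = d := by omega
    rw [this]

lemma cIJ_eq_s15 (n k I J : ℕ) (hk : 1 ≤ k) (hn : n = 3 * k + 2) (hIJ : I < J) (hJ : J < n) :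
    cIJ n k 3 I J = ((if J = I + (k + 1) then 1 else 0) - (if J = I + (n - (k + 1)) then 1 else 0))
      - ((if J = I + k then 1 else 0) - (if J = I + (n - k) then 1 else 0)) := by
  have h1 := zmod_diff n I J (k + 1) hIJ hJ (by omega)
  have h2 := zmod_diff n I J (2 * (k + 1)) hIJ hJ (by omega)
  have h3 := zmod_diff n I J k hIJ hJ (by omega)
  have h4 := zmod_diff n I J (2 * k + 1) hIJ hJ (by omega)
  have e : Finset.Icc 1 (3 - 1) = {1, 2} := by decide
  have e3 : (1 : ZMod n) * ((k : ZMod n) + 1) - 1 = (k : ZMod n) := by ring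
  have e4 : (2 : ZMod n) * ((k : ZMod n) + 1) - 1 = 2 * (k : ZMod n) + 1 := by ring
  push_cast at h1 h2 h3 h4
  unfold cIJ
  rw [e]
  simp only [Finset.mem_insert, Finset.mem_singleton, exists_eq_or_imp, exists_eq_left,
    Nat.cast_one, Nat.cast_ofNat, e3, e4, h2, h3, h4]
  simp only [one_mul, h1]
  split_ifs <;> omega

lemma T_eq_s15 (n r : ℕ) (hr : 0 < r) (hrn : r < n) {M : Type*} [AddCommGroup M] [Module ℤ M]
    (e : ZMod n → M) :
    T n e (r : ZMod n) = ∑ I ∈ Finset.range n, ∑ J ∈ Finset.range n,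
      (if I < J then ((if J = I + r then 1 else 0) - (if J = I + (n - r) then 1 else 0) : ℤ) else 0)
        • (ι ℤ (e (I : ZMod n)) * ι ℤ (e (J : ZMod n))) := by
  have hA : T n e (r : ZMod n) = ∑ I ∈ Finset.range n, ∑ J ∈ Finset.range n,
      ((if J = I + r then (1 : ℤ) else 0) • (ι ℤ (e (I : ZMod n)) * ι ℤ (e (J : ZMod n)))
       + (if J + n = I + r then (1 : ℤ) else 0)
          • (ι ℤ (e (I : ZMod n)) * ι ℤ (e (J : ZMod n)))) := by
    unfold T
    refine Finset.sum_congr rfl fun i hi => ?_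
    have hi := Finset.mem_range.1 hi
    by_cases h : i + r < n
    · rw [Finset.sum_eq_single (i + r)]
      · rw [if_pos rfl, if_neg (by omega)]
        simp
      · intro b hb hne
        have := Finset.mem_range.1 hb
        rw [if_neg hne, if_neg (by omega)]
        simp
      · intro h'
        exact absurd (Finset.mem_range.2 h) h'
    · rw [Finset.sum_eq_single (i + r - n)]
      · rw [if_neg (by omega), if_pos (by omega)]
        rw [Nat.cast_sub (by omega)]
        simp
      · intro b hb hne
        have := Finset.mem_range.1 hb
        rw [if_neg (by omega), if_neg (by omega)]
        simp
      · intro h'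
        exact absurd (Finset.mem_range.2 (by omega)) h'
  rw [hA]
  simp only [Finset.sum_add_distrib]
  rw [Finset.sum_comm (f := fun I J => (if J + n = I + r then (1 : ℤ) else 0)
          • (ι ℤ (e (I : ZMod n)) * ι ℤ (e (J : ZMod n))))]
  simp only [← Finset.sum_add_distrib]
  refine Finset.sum_congr rfl fun i hi => Finset.sum_congr rfl fun j hj => ?_
  have hi := Finset.mem_range.1 hi
  have hj := Finset.mem_range.1 hj
  have hs : ι ℤ (e (j : ZMod n)) * ι ℤ (e (i : ZMod n))
      = - (ι ℤ (e (i : ZMod n)) * ι ℤ (e (j : ZMod n))) :=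
    eq_neg_of_add_eq_zero_left (ι_add_mul_swap _ _)
  rw [hs, smul_neg, ← sub_eq_add_neg, ← sub_smul]
  congr 1
  split_ifs <;> omega

lemma Δ_eq (n k c : ℕ) {M : Type*} [AddCommGroup M] [Module ℤ M] (e : ZMod n → M)
    (he0 : e 0 = 0) (hn : 0 < n) :
    Δ n k c e = ∑ I ∈ Finset.range n, ∑ J ∈ Finset.range n,
      (if I < J then cIJ n k c I J else 0)
        • (ι ℤ (e (I : ZMod n)) * ι ℤ (e (J : ZMod n))) := by
  unfold Δ
  have h0 : ∀ I ∈ Finset.Icc 1 (n - 1), I ∈ Finset.range n := by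
    intro I hI
    simp at hI ⊢
    omega
  rw [← Finset.sum_subset h0]
  · refine Finset.sum_congr rfl fun I hI => ?_
    have h1 : Finset.Ioc I (n - 1) ⊆ Finset.range n := by
      intro J hJ
      simp at hJ ⊢
      omega
    rw [← Finset.sum_subset h1]
    · refine Finset.sum_congr rfl fun J hJ => ?_
      rw [if_pos (Finset.mem_Ioc.1 hJ).1]
    · intro J hJ hJ'
      simp only [Finset.mem_range, Finset.mem_Ioc] at hJ hJ'
      rw [if_neg (by omega), zero_smul]
  · intro I hI hI'
    simp only [Finset.mem_range, Finset.mem_Icc] at hI hI'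
    have : I = 0 := by omega
    subst this
    simp [he0]

theorem stmt15 (n k c : ℕ) (hn : Odd n) (hn3 : 3 ≤ n)
    (hk1 : 1 ≤ k) (hk2 : k ≤ n - 2) (hgcd : Nat.gcd n (k * (k + 1)) = 1)
    (hc1 : 1 ≤ c) (hc2 : c ≤ n - 1) (hc : (c * (k + 1)) % n = 1)
    (M : Type*) [AddCommGroup M] [Module ℤ M]
    (e : ZMod n → M) (he0 : e 0 = 0)
    (heInd : LinearIndependent ℤ (fun i : {x : ZMod n // x ≠ 0} => e i.val))
    (hn2 : n % 3 = 2) (hk : k = (n - 2) / 3) :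
    Δ n k c e = T n e ((k + 1 : ℕ) : ZMod n) - T n e ((k : ℕ) : ZMod n) := by
  have hn' : n = 3 * k + 2 := by omega
  have hc3 : c = 3 := by
    have h3 : (3 * (k + 1)) % n = 1 := by
      have : 3 * (k + 1) = 1 + n := by omega
      rw [this, Nat.add_mod_right, Nat.mod_eq_of_lt (by omega)]
    have hco : Nat.Coprime n (k + 1) := Nat.Coprime.coprime_mul_left_right hgcd
    have hm : c * (k + 1) ≡ 3 * (k + 1) [MOD n] := hc.trans h3.symm
    exact Nat.ModEq.eq_of_lt_of_lt (Nat.ModEq.cancel_right_of_coprime hco hm)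
      (by omega) (by omega)
  subst hc3
  rw [Δ_eq n k 3 e he0 (by omega), T_eq_s15 n (k + 1) (by omega) (by omega) e,
    T_eq_s15 n k (by omega) (by omega) e]
  simp only [← Finset.sum_sub_distrib, ← sub_smul]
  refine Finset.sum_congr rfl fun i hi => Finset.sum_congr rfl fun j hj => ?_
  by_cases h : i < j
  · rw [if_pos h, if_pos h, if_pos h, cIJ_eq_s15 n k i j hk1 hn' h (Finset.mem_range.1 hj)]
  · rw [if_neg h, if_neg h, if_neg h, sub_zero]

end Stmt
end
end
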